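/- For every k ≥ 4, the number of distinct smallest string attractors of the Fibonacci word F_{2k-1} is (2^{k-3} + 1)·2^{k-2}, and the number of distinct smallest string attractors of F_{2k} is (2^{k-2} + 1)·2^{k-2}. Equivalently, for every n ≥ 7 the number of smallest string attractors of F_n is 2^{n-4} + 2^{⌈n/2⌉-2}. -/

import Mathlib

/-- Fibonacci numbers: f 0 = f 1 = 1, f (n+2) = f (n+1) + f n. -/
def fib : ℕ → ℕ
  | 0 => 1
  | 1 => 1
  | n + 2 => fib (n + 1) + fib n

/-- Fibonacci words over {a, b}; `false` encodes `a`, `true` encodes `b`. -/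
def F : ℕ → List Bool
  | 0 => [true]
  | 1 => [false]
  | n + 2 => F (n + 1) ++ F n

/-- Singular words: S 0 = a, S 1 = b, S 2 = S 0 · S₋₁ · S 0 = aa,
and S n = S (n-2) · S (n-3) · S (n-2) for n ≥ 3. -/
def S : ℕ → List Bool
  | 0 => [false]
  | 1 => [true]
  | 2 => [false, false]
  | n + 3 => S (n + 1) ++ S n ++ S (n + 1)

/-- `w` occurs in `T` at (1-based) position `i`, i.e. `w = T[i .. i + |w| - 1]`. -/
def OccursAt {α : Type*} (T w : List α) (i : ℕ) : Prop :=
  1 ≤ i ∧ i + w.length ≤ T.length + 1 ∧ (T.drop (i - 1)).take w.length = w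

/-- `Γ` is a string attractor of `T`: a set of (1-based) positions of `T` such that
every nonempty substring of `T` has an occurrence crossing a position of `Γ`. -/
def IsAttractor {α : Type*} (T : List α) (Γ : Finset ℕ) : Prop :=
  (∀ k ∈ Γ, 1 ≤ k ∧ k ≤ T.length) ∧
  ∀ w : List α, w ≠ [] → w <:+: T →
    ∃ i, OccursAt T w i ∧ ∃ k ∈ Γ, i ≤ k ∧ k < i + w.length

/-- `Γ` is a smallest string attractor of `T`. -/
def IsSmallestAttractor {α : Type*} (T : List α) (Γ : Finset ℕ) : Prop :=
  IsAttractor T Γ ∧ ∀ Γ' : Finset ℕ, IsAttractor T Γ' → Γ.card ≤ Γ'.card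

/-- The set of all smallest string attractors of `T`. -/
def Att {α : Type*} (T : List α) : Set (Finset ℕ) := {Γ | IsSmallestAttractor T Γ}

theorem fib_rec (n : ℕ) : fib (n + 2) = fib (n + 1) + fib n := rfl

theorem fib_pos (n : ℕ) : 1 ≤ fib n ∧ 1 ≤ fib (n + 1) := by
  induction n with
  | zero => exact ⟨le_rfl, le_rfl⟩
  | succ n ih => have := fib_rec n; simp only [Nat.add_assoc, Nat.reduceAdd] at *; omega

theorem fib_mono_succ (n : ℕ) : fib n ≤ fib (n + 1) := by
  cases n with
  | zero => exact le_rfl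
  | succ n => have := fib_rec n; simp only [Nat.add_assoc, Nat.reduceAdd] at *; omega

theorem fib_mono {a b : ℕ} (h : a ≤ b) : fib a ≤ fib b :=
  monotone_nat_of_le_succ fib_mono_succ h

theorem le_fib (k : ℕ) : k ≤ fib k ∧ k + 1 ≤ fib (k + 1) := by
  induction k with
  | zero => exact ⟨by decide, by decide⟩
  | succ k ih =>
    have := fib_rec k
    rcases k with _ | k
    · decide
    · have := fib_pos (k + 1); simp only [Nat.add_assoc, Nat.reduceAdd] at *; omega

theorem F_len (n : ℕ) : (F n).length = fib n := by
  induction n using Nat.strong_induction_on with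
  | _ n ih =>
    match n with
    | 0 => rfl
    | 1 => rfl
    | n + 2 =>
      rw [F, List.length_append, ih (n + 1) (by omega), ih n (by omega), fib_rec]

theorem F_prefix (n j : ℕ) : F (n + 1) <+: F (n + 1 + j) := by
  induction j with
  | zero => exact List.prefix_rfl
  | succ j ih =>
    refine ih.trans ?_
    have : F (n + 1 + (j + 1)) = F (n + 1 + j) ++ F (n + j) := by
      have : n + 1 + (j + 1) = (n + j) + 2 := by omega
      rw [this, F]; congr 2; omega
    rw [this]; exact List.prefix_append _ _

/-- Infinite Fibonacci word, 1-based. -/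
def uu (k : ℕ) : Bool := (F (k + 1)).getD (k - 1) false

theorem F_get (n k : ℕ) (hn : 1 ≤ n) (hk : 1 ≤ k) (hkn : k ≤ fib n) :
    (F n)[k - 1]? = some (uu k) := by
  have h1 : (F (k + 1))[k - 1]? = some (uu k) := by
    have hl : k - 1 < (F (k + 1)).length := by
      rw [F_len]; have := (le_fib (k + 1)).1; omega
    rw [uu, List.getD_eq_getElem?_getD, List.getElem?_eq_getElem hl]; rfl
  obtain ⟨n, rfl⟩ : ∃ n', n = n' + 1 := ⟨n - 1, by omega⟩
  rcases le_total n k with h | h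
  · obtain ⟨j, rfl⟩ := Nat.exists_eq_add_of_le h
    have hp := F_prefix n j
    obtain ⟨t, ht⟩ := hp
    have h2 : n + j + 1 = n + 1 + j := by omega
    rw [h2, ← ht, List.getElem?_append_left (by rw [F_len]; omega)] at h1
    exact h1
  · obtain ⟨j, rfl⟩ := Nat.exists_eq_add_of_le h
    have hp := F_prefix k j
    obtain ⟨t, ht⟩ := hp
    have h2 : k + j + 1 = k + 1 + j := by omega
    rw [h2, ← ht, List.getElem?_append_left
      (by rw [F_len]; have := (le_fib (k + 1)).1; omega)]
    exact h1

/-- copy property -/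
theorem u_copy (n k : ℕ) (hn : 1 ≤ n) (hk : 1 ≤ k) (hkn : k ≤ fib n) :
    uu (fib (n + 1) + k) = uu k := by
  have h1 := F_get n k hn hk hkn
  have h2 := F_get (n + 2) (fib (n + 1) + k) (by omega) (by omega) (by rw [fib_rec]; omega)
  rw [F, List.getElem?_append_right (by rw [F_len]; omega), F_len] at h2
  have : fib (n + 1) + k - 1 - fib (n + 1) = k - 1 := by omega
  rw [this, h1] at h2
  exact (Option.some.inj h2).symm

theorem u_per (n k : ℕ) (hn : 1 ≤ n) (hk : 1 ≤ k) (hkn : k + 2 ≤ fib (n + 1)) :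
    uu (fib n + k) = uu k := by
  induction n generalizing k with
  | zero => omega
  | succ n ih =>
    rcases n with _ | n
    · have : fib (0 + 1 + 1) = 2 := rfl
      omega
    · by_cases h : k ≤ fib (n + 1)
      · exact u_copy (n + 1) k (by omega) hk h
      · obtain ⟨r, rfl⟩ : ∃ r, k = fib (n + 1) + r := ⟨k - fib (n + 1), by omega⟩
        have e1 := fib_rec (n + 1)
        have e2 := fib_rec n
        rw [ih r (by omega) (by omega) (by simp only [Nat.add_assoc, Nat.reduceAdd] at *; omega)]
        have := u_copy (n + 2) r (by omega) (by omega) (by simp only [Nat.add_assoc, Nat.reduceAdd] at *; omega)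
        rw [← this]; congr 1; simp only [Nat.add_assoc, Nat.reduceAdd] at *; omega

theorem u_last (n : ℕ) : uu (fib (n + 1)) ≠ uu (fib (n + 2)) := by
  induction n with
  | zero => decide
  | succ n ih =>
    have := u_copy (n + 1) (fib (n + 1)) (by omega) (fib_pos _).2 le_rfl
    have e : fib (n + 1 + 2) = fib (n + 1 + 1) + fib (n + 1) := rfl
    rw [e, this]; exact ih.symm

/-- number of b's in a window -/
def cnt (s L : ℕ) : ℕ := ∑ x ∈ Finset.range L, (uu (s + x)).toNat

theorem cnt_shift (s L : ℕ) : cnt (s + 1) L + (uu s).toNat = cnt s L + (uu (s + L)).toNat := by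
  have h1 := Finset.sum_range_succ (fun x => (uu (s + x)).toNat) L
  have h2 := Finset.sum_range_succ' (fun x => (uu (s + x)).toNat) L
  unfold cnt
  have h3 : ∀ x, s + 1 + x = s + (x + 1) := by intro x; omega
  simp only [h3]
  simp only [add_zero] at h2
  omega

/-- S_m occurs at s -/
def W (m s : ℕ) : Prop := 1 ≤ s ∧ ∀ x < fib m, uu (s + x) = uu (fib (m + 1) + x)

theorem cnt_const (m s : ℕ) (hm : 1 ≤ m) (hs : s + 1 + fib m + 1 ≤ fib (m + 2)) :
    cnt (s + 1) (fib m) = cnt 1 (fib m) := by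
  induction s with
  | zero => rfl
  | succ s ih =>
    have h := cnt_shift (s + 1) (fib m)
    have e := fib_rec m
    have := u_per m (s + 1) hm (by omega) (by omega)
    rw [add_comm] at this
    rw [this] at h
    rw [← ih (by omega)]; omega

theorem cnt_congr (s t L : ℕ) (h : ∀ x < L, uu (s + x) = uu (t + x)) : cnt s L = cnt t L := by
  unfold cnt
  exact Finset.sum_congr rfl fun x hx => by rw [h x (Finset.mem_range.1 hx)]

theorem L1 (m s : ℕ) (h : W m s) (hs : s + fib m + 1 ≤ fib (m + 2)) : False := by
  obtain ⟨h1, h⟩ := h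
  have e := fib_rec m
  rcases m with _ | m
  · have : fib (0 + 1) = 1 := rfl
    omega
  obtain ⟨s, rfl⟩ : ∃ s', s = s' + 1 := ⟨s - 1, by omega⟩
  have c1 := cnt_const (m + 1) s (by omega) hs
  have c2 := cnt_congr _ _ _ h
  have c3 := cnt_shift (fib (m + 1 + 1)) (fib (m + 1))
  have c4 : cnt (fib (m + 1 + 1) + 1) (fib (m + 1)) = cnt 1 (fib (m + 1)) := by
    apply cnt_congr
    intro x hx
    have := u_copy (m + 1) (1 + x) (by omega) (by omega) (by omega)
    rw [← this]; congr 1; omega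
  have c5 := u_last (m + 1)
  rw [← e] at c3
  have : (uu (fib (m + 1 + 1))).toNat = (uu (fib (m + 1 + 2))).toNat := by omega
  apply c5
  revert this
  generalize uu (fib (m + 1 + 1)) = p
  generalize uu (fib (m + 1 + 2)) = q
  revert p q; decide

/-- an occurrence in PER_{n+1} lies in one of the two copies of PER_n, or straddles. -/
theorem Lsplit (m n s : ℕ) (hn : 2 ≤ n) (h : W m s) (hs : s + fib m + 1 ≤ fib (n + 1)) :
    s + fib m + 1 ≤ fib n ∨
    (∃ s', s = fib (n - 1) + s' ∧ W m s' ∧ s' + fib m + 1 ≤ fib n) ∨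
    (s ≤ fib (n - 1) ∧ fib n ≤ s + fib m) := by
  obtain ⟨n, rfl⟩ : ∃ n', n = n' + 2 := ⟨n - 2, by omega⟩
  have e1 := fib_rec (n + 1)
  simp only [show n + 2 - 1 = n + 1 by omega]
  by_cases h1 : s + fib m + 1 ≤ fib (n + 2)
  · exact Or.inl h1
  by_cases h2 : s ≤ fib (n + 1)
  · right; right; omega
  right; left
  refine ⟨s - fib (n + 1), by omega, ⟨by omega, fun x hx => ?_⟩, by simp only [Nat.add_assoc, Nat.reduceAdd] at *; omega⟩
  rw [← h.2 x hx, ← u_per (n + 1) (s - fib (n + 1) + x) (by omega) (by omega) (by simp only [Nat.add_assoc, Nat.reduceAdd] at *; omega)]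
  congr 1; omega

theorem L2 (m s : ℕ) (h : W m s) (hs : s + fib m + 1 ≤ fib (m + 3)) : s = fib (m + 1) := by
  rcases Lsplit m (m + 2) s (by omega) h hs with h1 | ⟨s', h1, h2, h3⟩ | h1
  · exact (L1 m s h h1).elim
  · exact (L1 m s' h2 h3).elim
  · have := fib_rec m
    simp only [show m + 2 - 1 = m + 1 by omega] at h1
    omega

theorem L3 (m n s : ℕ) (hn : m + 3 ≤ n) (h : W m s) (hs : s + fib m + 1 ≤ fib (n + 1)) :
    s + fib m + 1 ≤ fib n ∨
    (∃ s', s = fib (n - 1) + s' ∧ W m s' ∧ s' + fib m + 1 ≤ fib n) := by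
  rcases Lsplit m n s (by omega) h hs with h1 | h1 | h1
  · exact Or.inl h1
  · exact Or.inr h1
  · exfalso
    obtain ⟨n, rfl⟩ : ∃ n', n = n' + 3 := ⟨n - 3, by omega⟩
    have e1 := fib_rec (n + 1)
    simp only [show n + 3 - 1 = n + 2 by omega] at h1
    have e2 : fib (m + 1) ≤ fib (n + 1) := fib_mono (by omega)
    have e3 := fib_mono_succ m
    have e4 : fib (m + 1) = fib m := by simp only [Nat.add_assoc, Nat.reduceAdd] at *; omega
    have e6 : s = fib (n + 2) := by simp only [Nat.add_assoc, Nat.reduceAdd] at *; omega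
    rcases m with _ | m
    · rcases n with _ | n
      · have := h.2 0 (by decide)
        rw [e6] at this
        revert this; decide
      · have a1 := fib_rec n
        have a2 := fib_pos n
        have a3 : fib (0 + 1) = 1 := rfl
        simp only [Nat.add_assoc, Nat.reduceAdd] at *; omega
    · have := fib_rec m
      have := fib_pos m
      simp only [Nat.add_assoc, Nat.reduceAdd] at *; omega

theorem K (n m s : ℕ) (h : W m s) (hs : s + fib m + 1 ≤ fib n) :
    ∃ d, s = d + fib (m + 1) ∧ d + fib (m + 3) ≤ fib n ∧
      ∀ y, 1 ≤ y → y + 2 ≤ fib (m + 3) → uu (d + y) = uu y := by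
  induction n generalizing s with
  | zero =>
    have : fib 0 = 1 := rfl
    have := h.1
    omega
  | succ n ih =>
    by_cases hn : n + 1 ≤ m + 2
    · have := fib_mono hn
      exact (L1 m s h (by omega)).elim
    by_cases hn2 : n + 1 ≤ m + 3
    · have := fib_mono hn2
      have h1 := L2 m s h (by omega)
      have h2 : n + 1 = m + 3 := by omega
      exact ⟨0, by omega, by rw [h2]; omega, fun y _ _ => by simp⟩
    rcases L3 m n s (by omega) h hs with h1 | ⟨s', h1, h2, h3⟩
    · obtain ⟨d, h4, h5, h6⟩ := ih s h h1
      have := fib_mono_succ n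
      exact ⟨d, h4, by omega, h6⟩
    · obtain ⟨d, h4, h5, h6⟩ := ih s' h2 h3
      obtain ⟨n, rfl⟩ : ∃ n', n = n' + 2 := ⟨n - 2, by omega⟩
      simp only [show n + 2 - 1 = n + 1 by omega] at h1
      have e1 := fib_rec (n + 1)
      refine ⟨fib (n + 1) + d, by omega, by simp only [Nat.add_assoc, Nat.reduceAdd] at *; omega, fun y hy1 hy2 => ?_⟩
      rw [← h6 y hy1 hy2, add_assoc]
      exact u_per (n + 1) (d + y) (by omega) (by omega) (by simp only [Nat.add_assoc, Nat.reduceAdd] at *; omega)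

theorem K' (m s : ℕ) (h : W m s) :
    ∃ d, s = d + fib (m + 1) ∧
      ∀ y, 1 ≤ y → y + 2 ≤ fib (m + 3) → uu (d + y) = uu y := by
  obtain ⟨d, h1, -, h2⟩ := K (s + fib m + 1) m s h (le_fib _).1
  exact ⟨d, h1, h2⟩

theorem C4 (m s : ℕ) (h : W m s) (hs : s + fib m + 1 ≤ fib (m + 4)) :
    s = fib (m + 1) ∨ s = fib (m + 2) + fib (m + 1) := by
  rcases L3 m (m + 3) s (by omega) h hs with h1 | ⟨s', h1, h2, h3⟩
  · exact Or.inl (L2 m s h h1)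
  · have := L2 m s' h2 h3
    right; rw [h1, this]; rfl

theorem C5 (m s : ℕ) (h : W m s) (hs : s + fib m + 1 ≤ fib (m + 5)) :
    s = fib (m + 1) ∨ s = fib (m + 2) + fib (m + 1) ∨
    s = fib (m + 3) + fib (m + 1) ∨ s = fib (m + 4) + fib (m + 1) := by
  rcases L3 m (m + 4) s (by omega) h hs with h1 | ⟨s', h1, h2, h3⟩
  · have := C4 m s h h1; tauto
  · have e := fib_rec (m + 2)
    simp only [show m + 4 - 1 = m + 3 by omega] at h1
    have := C4 m s' h2 h3
    simp only [Nat.add_assoc, Nat.reduceAdd] at *; omega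

theorem W_pull (m s d N : ℕ) (h : W m s) (hd : d < s) (hs : s + fib m + 1 ≤ d + N)
    (hp : ∀ y, 1 ≤ y → y + 2 ≤ N → uu (d + y) = uu y) : W m (s - d) := by
  refine ⟨by omega, fun x hx => ?_⟩
  rw [← h.2 x hx, ← hp (s - d + x) (by omega) (by omega)]
  congr 1; omega

theorem disj (m s t : ℕ) (h : W m s) (h' : W (m + 1) t) :
    s + fib m ≤ t ∨ t + fib (m + 1) ≤ s := by
  by_contra hc
  obtain ⟨d, h1, h2⟩ := K' (m + 1) t h'
  have e1 := fib_rec m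
  have e2 := fib_rec (m + 1)
  have e3 := fib_rec (m + 2)
  have p1 := fib_pos m
  simp only [show m + 1 + 1 = m + 2 by omega, show m + 1 + 2 = m + 3 by omega,
    show m + 1 + 3 = m + 4 by omega, show m + 2 + 1 = m + 3 by omega,
    show m + 2 + 2 = m + 4 by omega] at *
  have := W_pull m s d (fib (m + 4)) h (by omega) (by omega) h2
  rcases C4 m (s - d) this (by omega) with h3 | h3 <;> omega

theorem nest (m s t : ℕ) (h : W m s) (h' : W (m + 2) t) (h1 : s < t + fib (m + 2))
    (h2 : t < s + fib m) : s = t ∨ s = t + fib (m + 1) := by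
  obtain ⟨d, h3, h4⟩ := K' (m + 2) t h'
  have e1 := fib_rec m
  have e2 := fib_rec (m + 1)
  have e3 := fib_rec (m + 2)
  have e4 := fib_rec (m + 3)
  have p1 := fib_pos m
  simp only [show m + 1 + 1 = m + 2 by omega, show m + 1 + 2 = m + 3 by omega,
    show m + 2 + 3 = m + 5 by omega, show m + 2 + 1 = m + 3 by omega,
    show m + 2 + 2 = m + 4 by omega, show m + 3 + 1 = m + 4 by omega,
    show m + 3 + 2 = m + 5 by omega] at *
  have := W_pull m s d (fib (m + 5)) h (by omega) (by omega) h4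
  rcases C5 m (s - d) this (by omega) with h5 | h5 | h5 | h5 <;> omega

/-- digit sets -/
def Dg : ℕ → Finset ℕ
  | 0 => {0}
  | 1 => {0}
  | m + 2 => Dg m ∪ (Dg m).image (· + fib (m + 1))

theorem mem_Dg (m x : ℕ) : x ∈ Dg (m + 2) ↔ x ∈ Dg m ∨ ∃ y ∈ Dg m, y + fib (m + 1) = x := by
  simp [Dg]

theorem Dg_lt (m x : ℕ) (h : x ∈ Dg m) : x < fib m := by
  induction m using Nat.strong_induction_on generalizing x with
  | _ m ih =>
    match m with
    | 0 => simp [Dg] at h; simp [h, fib]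
    | 1 => simp [Dg] at h; simp [h, fib]
    | m + 2 =>
      have e := fib_rec m
      rcases (mem_Dg m x).1 h with h | ⟨y, hy, rfl⟩
      · have := ih m (by omega) x h; omega
      · have := ih m (by omega) y hy; omega

theorem zero_mem_Dg (m : ℕ) : 0 ∈ Dg m := by
  induction m using Nat.strong_induction_on with
  | _ m ih =>
    match m with
    | 0 => simp [Dg]
    | 1 => simp [Dg]
    | m + 2 => exact (mem_Dg m 0).2 (Or.inl (ih m (by omega)))

theorem Dg_disj (m : ℕ) : Disjoint (Dg m) ((Dg m).image (· + fib (m + 1))) := by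
  rw [Finset.disjoint_left]
  intro x hx hx'
  obtain ⟨y, hy, rfl⟩ := Finset.mem_image.1 hx'
  have := Dg_lt m _ hx
  have := fib_mono_succ m
  omega

theorem Dg_card (m : ℕ) : (Dg m).card = 2 ^ (m / 2) := by
  induction m using Nat.strong_induction_on with
  | _ m ih =>
    match m with
    | 0 => rfl
    | 1 => rfl
    | m + 2 =>
      rw [Dg, Finset.card_union_of_disjoint (Dg_disj m),
        Finset.card_image_of_injective _ (add_left_injective _), ih m (by omega)]
      rw [show (m + 2) / 2 = m / 2 + 1 by omega, pow_succ]; omega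

/-- necessity chain -/
theorem chainN (m i j s t : ℕ) (h1 : W (m + 1) s) (h2 : W m t)
    (hi : s ≤ i ∧ i < s + fib (m + 1)) (hj : t ≤ j ∧ j < t + fib m)
    (hit : ∀ m' < m, ∃ r, W m' r ∧ (r ≤ i ∧ i < r + fib m' ∨ r ≤ j ∧ j < r + fib m')) :
    i - s ∈ Dg (m + 1) ∧ j - t ∈ Dg m := by
  induction m generalizing i j s t with
  | zero =>
    have : fib (0 + 1) = 1 := rfl
    have : fib 0 = 1 := rfl
    simp only [Dg, zero_add, Finset.mem_singleton]
    omega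
  | succ m ih =>
    obtain ⟨r, hr, hr2⟩ := hit m (by omega)
    have hr3 : r ≤ i ∧ i < r + fib m := by
      rcases hr2 with h | h
      · exact h
      · have := disj m r t hr h2; omega
    have hn := nest m r s hr h1 (by have : fib (m + 1 + 1) = fib (m + 2) := rfl
                                    omega) (by omega)
    obtain ⟨a1, a2⟩ := ih j i t r h2 hr hj hr3 (fun m' hm' => by
      obtain ⟨r, h, h'⟩ := hit m' (by omega)
      exact ⟨r, h, h'.symm⟩)
    refine ⟨(mem_Dg m _).2 ?_, a1⟩
    rcases hn with rfl | rfl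
    · exact Or.inl a2
    · exact Or.inr ⟨_, a2, by omega⟩

/-- PER_{m+3} occurs at offset d -/
def Pr (m d : ℕ) : Prop := ∀ y, 1 ≤ y → y + 2 ≤ fib (m + 3) → uu (d + y) = uu y

theorem Pr_step (m d r : ℕ) (h : Pr (m + 2) d) (hr : r = m + 2 ∨ r = m + 3) :
    Pr m (d + fib r) := by
  intro y h1 h2
  have e2 := fib_rec (m + 1)
  have e3 := fib_rec (m + 2)
  have e4 := fib_rec (m + 3)
  have : fib r ≤ fib (m + 3) := fib_mono (by omega)
  have := fib_mono_succ (m + 2)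
  have : uu (fib r + y) = uu y := by
    rcases hr with rfl | rfl
    · exact u_per (m + 2) y (by omega) h1 h2
    · exact u_per (m + 3) y (by omega) h1 (by simp only [Nat.add_assoc, Nat.reduceAdd] at *; omega)
  rw [← this, add_assoc]
  exact h _ (by omega) (by
    simp only [show m + 2 + 3 = m + 3 + 2 by omega]; simp only [Nat.add_assoc, Nat.reduceAdd] at *; omega)

theorem chainS (m d x m' : ℕ) (h : Pr m d) (hx : x ∈ Dg m) (hm : m' ≤ m)
    (hpar : m' % 2 = m % 2) :
    ∃ d', Pr m' d' ∧ d' + fib (m' + 3) ≤ d + fib (m + 3) ∧ d' + fib (m' + 2) ≤ d + fib (m + 2) ∧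
      d' + fib (m' + 1) ≤ d + fib (m + 1) + x ∧ d + fib (m + 1) + x < d' + fib (m' + 2) := by
  induction m using Nat.strong_induction_on generalizing d x with
  | _ m ih =>
    by_cases hmm : m' = m
    · subst hmm
      have := Dg_lt m' x hx
      have := fib_rec m'
      exact ⟨d, h, le_rfl, le_rfl, by omega, by omega⟩
    obtain ⟨m, rfl⟩ : ∃ q, m = q + 2 := ⟨m - 2, by omega⟩
    have e1 : fib (m + 2) = fib (m + 1) + fib m := rfl
    have e2 : fib (m + 3) = fib (m + 2) + fib (m + 1) := rfl
    have e3 : fib (m + 4) = fib (m + 3) + fib (m + 2) := rfl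
    have e4 : fib (m + 5) = fib (m + 4) + fib (m + 3) := rfl
    have e5 : fib (m + 2 + 1) = fib (m + 3) := rfl
    have e6 : fib (m + 2 + 2) = fib (m + 4) := rfl
    have e7 : fib (m + 2 + 3) = fib (m + 5) := rfl
    rcases (mem_Dg m x).1 hx with hx | ⟨z, hz, rfl⟩
    · obtain ⟨d', a1, a2, a3, a4, a5⟩ := ih m (by omega) (d + fib (m + 2)) x
        (Pr_step m d _ h (Or.inl rfl)) hx (by omega) (by omega)
      exact ⟨d', a1, by omega, by omega, by omega, by omega⟩
    · obtain ⟨d', a1, a2, a3, a4, a5⟩ := ih m (by omega) (d + fib (m + 3)) z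
        (Pr_step m d _ h (Or.inr rfl)) hz (by omega) (by omega)
      exact ⟨d', a1, by omega, by omega, by omega, by omega⟩

theorem Pr_zero (m : ℕ) : Pr m 0 := fun y _ _ => by simp

theorem chainR (q j M : ℕ) (h : M + 2 * j = q) :
    ∃ d, d + fib (M + 2) = fib (q + 2) ∧ Pr M d := by
  induction j generalizing M with
  | zero =>
    obtain rfl : M = q := by omega
    exact ⟨0, by omega, Pr_zero _⟩
  | succ j ih =>
    obtain ⟨d, h1, h2⟩ := ih (M + 2) (by omega)
    have e3 : fib (M + 2 + 2) = fib (M + 3) + fib (M + 2) := rfl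
    exact ⟨d + fib (M + 3), by omega, Pr_step M d _ h2 (Or.inr rfl)⟩

theorem classify (L s : ℕ) (hs : 1 ≤ s) (hL : 1 ≤ L) :
    ∃ s' m, 1 ≤ s' ∧ s' ≤ s ∧ (∀ x < L, uu (s' + x) = uu (s + x)) ∧ s' ≤ fib (m + 1) ∧
      fib (m + 2) ≤ s' + L ∧ s' + L + 1 ≤ fib (m + 3) := by
  induction s using Nat.strong_induction_on with
  | _ s ih =>
    have hex : ∃ m, s + L + 1 ≤ fib (m + 3) :=
      ⟨s + L, le_trans (by omega) (le_fib (s + L + 3)).1⟩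
    obtain ⟨m, h1, h2⟩ : ∃ m, s + L + 1 ≤ fib (m + 3) ∧ fib (m + 2) ≤ s + L := by
      classical
      refine ⟨Nat.find hex, Nat.find_spec hex, ?_⟩
      rcases hm : Nat.find hex with _ | m
      · have : fib (0 + 2) = 2 := rfl
        omega
      · have := Nat.find_min hex (m := m) (by omega)
        have e : fib (m + 1 + 2) = fib (m + 3) := rfl
        omega
    by_cases h : s ≤ fib (m + 1)
    · exact ⟨s, m, hs, le_rfl, fun _ _ => rfl, h, h2, h1⟩
    · have p := fib_pos m
      have e3 : fib (m + 3) = fib (m + 2) + fib (m + 1) := rfl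
      obtain ⟨s', m', a1, a2, a3, a4⟩ := ih (s - fib (m + 1)) (by omega) (by omega)
      refine ⟨s', m', a1, by omega, fun x hx => ?_, a4⟩
      rw [a3 x hx, ← u_per (m + 1) (s - fib (m + 1) + x) (by omega) (by omega) (by
        have e5 : fib (m + 1 + 1) = fib (m + 2) := rfl
        omega)]
      congr 1; omega

/-- covering condition in terms of the infinite word -/
def Attr (n : ℕ) (Γ : Finset ℕ) : Prop :=
  ∀ s L, 1 ≤ s → 1 ≤ L → s + L ≤ fib n + 1 → ∃ t, 1 ≤ t ∧ t + L ≤ fib n + 1 ∧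
    (∀ x < L, uu (t + x) = uu (s + x)) ∧ ∃ k ∈ Γ, t ≤ k ∧ k < t + L

theorem suff (p x y : ℕ) (hx : x ∈ Dg (p + 4)) (hy : y ∈ Dg (p + 5))
    (hxy : y ∈ Dg (p + 3) ∨ x ≤ 1) : Attr (p + 7) {fib (p + 5) + x, fib (p + 6) + y} := by
  intro s0 L hs0 hL hsL
  obtain ⟨s, m, b1, b2, b3, b4, b5, b6⟩ := classify L s0 hs0 hL
  have g6 : fib (p + 6) = fib (p + 5) + fib (p + 4) := rfl
  have g7 : fib (p + 7) = fib (p + 6) + fib (p + 5) := rfl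
  have g8 : fib (p + 8) = fib (p + 7) + fib (p + 6) := rfl
  have p4 := fib_pos (p + 4)
  have hm : m ≤ p + 5 := by
    by_contra hc
    have : fib (p + 8) ≤ fib (m + 2) := fib_mono (by omega)
    have : fib (p + 4 + 1) = fib (p + 5) := rfl
    omega
  have f1 := fib_mono_succ (m + 1)
  have e3 : fib (m + 3) = fib (m + 2) + fib (m + 1) := rfl
  have e2 : fib (m + 2) = fib (m + 1) + fib m := rfl
  have f2 : fib (m + 1 + 1) = fib (m + 2) := rfl
  -- transport along an occurrence of the extension
  have key : ∀ d k, Pr m d → s + d + L ≤ fib (p + 7) + 1 →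
      k ∈ ({fib (p + 5) + x, fib (p + 6) + y} : Finset ℕ) → s + d ≤ k → k < s + d + L →
      ∃ t, 1 ≤ t ∧ t + L ≤ fib (p + 7) + 1 ∧
      (∀ x < L, uu (t + x) = uu (s0 + x)) ∧
      ∃ k ∈ ({fib (p + 5) + x, fib (p + 6) + y} : Finset ℕ), t ≤ k ∧ k < t + L := by
    intro d k hP h1 h2 h3 h4
    refine ⟨s + d, by omega, h1, fun z hz => ?_, k, h2, h3, h4⟩
    rw [← b3 z hz, ← hP (s + z) (by omega) (by omega)]
    congr 1; omega
  by_cases hpar : m % 2 = (p + 4) % 2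
  · obtain ⟨d, a1, a2, a3, a4, a5⟩ := chainS (p + 4) 0 x m (Pr_zero _) hx (by omega) hpar
    simp only [Nat.add_assoc, Nat.reduceAdd, zero_add] at a2 a3 a4 a5
    exact key d (fib (p + 5) + x) a1 (by omega) (by simp) (by omega) (by omega)
  have hpar5 : m % 2 = (p + 5) % 2 := by omega
  have hylt := Dg_lt _ _ hy
  rcases hxy with hy3 | hx1
  · by_cases hm5 : m = p + 5
    · subst hm5
      simp only [Nat.add_assoc, Nat.reduceAdd] at *
      exact key 0 (fib (p + 6) + y) (Pr_zero _) (by omega) (by simp) (by omega) (by omega)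
    · obtain ⟨d, a1, a2, a3, a4, a5⟩ := chainS (p + 3) (0 + fib (p + 5)) y m
        (Pr_step (p + 3) 0 (p + 5) (Pr_zero _) (Or.inl rfl)) hy3 (by omega) (by omega)
      simp only [Nat.add_assoc, Nat.reduceAdd, zero_add] at a2 a3 a4 a5
      exact key d (fib (p + 6) + y) a1 (by omega) (by simp) (by omega) (by omega)
  · by_cases he : s + L ≤ fib (m + 2) + 1
    · obtain ⟨d, a1, a2, a3, a4, a5⟩ := chainS (p + 5) 0 y m (Pr_zero _) hy (by omega) hpar5
      simp only [Nat.add_assoc, Nat.reduceAdd, zero_add] at a2 a3 a4 a5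
      exact key d (fib (p + 6) + y) a1 (by omega) (by simp) (by omega) (by omega)
    · have hm5 : m ≠ p + 5 := by
        rintro rfl
        simp only [Nat.add_assoc, Nat.reduceAdd] at *
        omega
      obtain ⟨d, a1, a2⟩ := chainR (p + 3) ((p + 3 - m) / 2) m (by omega)
      simp only [Nat.add_assoc, Nat.reduceAdd] at a1
      have : fib (m + 1) ≤ fib (p + 6) := fib_mono (by omega)
      exact key d (fib (p + 5) + x) a2 (by omega) (by simp) (by omega) (by omega)

theorem hits (n : ℕ) (Γ : Finset ℕ) (h : Attr n Γ) (m : ℕ) (hm : m + 2 ≤ n) :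
    ∃ r, W m r ∧ r + fib m ≤ fib n + 1 ∧ ∃ k ∈ Γ, r ≤ k ∧ k < r + fib m := by
  have e2 : fib (m + 2) = fib (m + 1) + fib m := rfl
  have := fib_mono hm
  have p := fib_pos m
  obtain ⟨t, h1, h2, h3, h4⟩ := h (fib (m + 1)) (fib m) (by omega) (by omega) (by omega)
  exact ⟨t, ⟨h1, h3⟩, h2, h4⟩

theorem fib_ge (p : ℕ) : 2 ≤ fib (p + 2) ∧ 3 ≤ fib (p + 3) := by
  have h2 : fib 2 ≤ fib (p + 2) := fib_mono (by omega)
  have h3 : fib 3 ≤ fib (p + 3) := fib_mono (by omega)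
  exact ⟨h2, h3⟩

theorem nec1 (p : ℕ) (Γ : Finset ℕ) (h : Attr (p + 7) Γ) :
    ∃ i ∈ Γ, ∃ j ∈ Γ, fib (p + 5) ≤ i ∧ i < fib (p + 6) ∧ fib (p + 6) ≤ j ∧ j < fib (p + 7) := by
  obtain ⟨r, h1, h2, j, hj, hj1, hj2⟩ := hits _ Γ h (p + 5) (by omega)
  obtain ⟨r', h1', h2', i, hi, hi1, hi2⟩ := hits _ Γ h (p + 4) (by omega)
  have g6 : fib (p + 6) = fib (p + 5) + fib (p + 4) := rfl
  have g7 : fib (p + 7) = fib (p + 6) + fib (p + 5) := rfl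
  have g8 : fib (p + 8) = fib (p + 7) + fib (p + 6) := rfl
  have q := fib_ge (p + 2)
  have q3 := fib_ge (p + 3)
  simp only [Nat.add_assoc, Nat.reduceAdd] at q q3
  have c1 := L2 (p + 5) r h1 (by simp only [Nat.add_assoc, Nat.reduceAdd] at *; omega)
  have c2 := C4 (p + 4) r' h1' (by simp only [Nat.add_assoc, Nat.reduceAdd] at *; omega)
  simp only [Nat.add_assoc, Nat.reduceAdd] at c1 c2
  exact ⟨i, hi, j, hj, by omega, by omega, by omega, by omega⟩

theorem nec2 (p i j : ℕ) (h : Attr (p + 7) {i, j})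
    (hi : fib (p + 5) ≤ i ∧ i < fib (p + 6)) (hj : fib (p + 6) ≤ j ∧ j < fib (p + 7)) :
    ∃ x y, x ∈ Dg (p + 4) ∧ y ∈ Dg (p + 5) ∧ (y ∈ Dg (p + 3) ∨ x ≤ 1) ∧
      i = fib (p + 5) + x ∧ j = fib (p + 6) + y := by
  have g4 : fib (p + 4) = fib (p + 3) + fib (p + 2) := rfl
  have g5 : fib (p + 5) = fib (p + 4) + fib (p + 3) := rfl
  have g6 : fib (p + 6) = fib (p + 5) + fib (p + 4) := rfl
  have g7 : fib (p + 7) = fib (p + 6) + fib (p + 5) := rfl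
  have g8 : fib (p + 8) = fib (p + 7) + fib (p + 6) := rfl
  have q := fib_ge p
  have q2 : 2 ≤ fib (p + 4) := (fib_ge (p + 2)).1
  obtain ⟨c1, c2⟩ := chainN (p + 4) j i (fib (p + 6)) (fib (p + 5))
    ⟨by omega, fun _ _ => rfl⟩ ⟨by omega, fun _ _ => rfl⟩
    (by simp only [Nat.add_assoc, Nat.reduceAdd]; omega) (by omega) (by
      intro m' hm'
      obtain ⟨r, a1, -, k, hk, a2⟩ := hits _ _ h m' (by omega)
      refine ⟨r, a1, ?_⟩
      simp only [Finset.mem_insert, Finset.mem_singleton] at hk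
      rcases hk with rfl | rfl
      · exact Or.inr a2
      · exact Or.inl a2)
  refine ⟨i - fib (p + 5), j - fib (p + 6), c2, c1, ?_, by omega, by omega⟩
  rcases (mem_Dg (p + 3) _).1 c1 with h1 | ⟨z, hz, hz2⟩
  · exact Or.inl h1
  right
  simp only [Nat.add_assoc, Nat.reduceAdd] at hz2
  obtain ⟨t, a1, a2, a3, k, hk, a4, a5⟩ := h (fib (p + 4)) (fib (p + 3) + 2) (by omega) (by omega)
    (by omega)
  have hW : W (p + 3) t := ⟨a1, fun x hx => a3 x (by omega)⟩
  have hc := C5 (p + 3) t hW (by simp only [Nat.add_assoc, Nat.reduceAdd]; omega)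
  simp only [Nat.add_assoc, Nat.reduceAdd] at hc
  simp only [Finset.mem_insert, Finset.mem_singleton] at hk
  rcases hk with rfl | rfl <;> omega

theorem win (n s L : ℕ) (hn : 1 ≤ n) (hs : 1 ≤ s) (hL : s + L ≤ fib n + 1) :
    ((F n).drop (s - 1)).take L = (List.range L).map (fun x => uu (s + x)) := by
  apply List.ext_getElem?
  intro x
  by_cases hx : x < L
  · rw [List.getElem?_take_of_lt hx, List.getElem?_drop]
    have := F_get n (s + x) hn (by omega) (by omega)
    rw [show s - 1 + x = s + x - 1 by omega, this]
    simp [hx]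
  · rw [List.getElem?_eq_none (by simp; omega), List.getElem?_eq_none (by simp; omega)]

theorem isAttractor_iff (n : ℕ) (hn : 1 ≤ n) (Γ : Finset ℕ) :
    IsAttractor (F n) Γ ↔ (∀ k ∈ Γ, 1 ≤ k ∧ k ≤ fib n) ∧ Attr n Γ := by
  unfold IsAttractor Attr OccursAt
  rw [F_len]
  refine and_congr Iff.rfl ⟨fun h s L hs hL hsL => ?_, fun h w hw hwF => ?_⟩
  · obtain ⟨t, ⟨h1, h2, h3⟩, h4⟩ := h (((F n).drop (s - 1)).take L)
      (by
        rw [win n s L hn hs hsL]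
        intro h0
        have := congrArg List.length h0
        simp at this; omega)
      ((List.take_prefix _ _).isInfix.trans (List.drop_suffix _ _).isInfix)
    rw [win n s L hn hs hsL] at h2 h3 h4
    simp only [List.length_map, List.length_range] at h2 h3 h4
    rw [win n t L hn h1 h2] at h3
    refine ⟨t, h1, h2, fun x hx => ?_, h4⟩
    have := congrArg (fun l => l[x]?) h3
    simpa [hx] using this
  · obtain ⟨a, b, hab⟩ := hwF
    have hlen := congrArg List.length hab
    simp only [List.length_append, F_len] at hlen
    have hw1 : 1 ≤ w.length := List.length_pos_iff.2 hw
    obtain ⟨t, h1, h2, h3, h4⟩ := h (a.length + 1) w.length (by omega) hw1 (by omega)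
    refine ⟨t, ⟨h1, h2, ?_⟩, h4⟩
    have h5 := win n (a.length + 1) w.length hn (by omega) (by omega)
    have h6 : ((F n).drop (a.length + 1 - 1)).take w.length = w := by
      rw [← hab]; simp
    rw [win n t w.length hn h1 h2, ← h6, h5]
    simp only [List.length_map, List.length_range]
    apply List.map_congr_left
    intro x hx
    exact h3 x (List.mem_range.1 hx)

theorem attractor_good (p x y : ℕ) (hx : x ∈ Dg (p + 4)) (hy : y ∈ Dg (p + 5))
    (hxy : y ∈ Dg (p + 3) ∨ x ≤ 1) :
    IsAttractor (F (p + 7)) {fib (p + 5) + x, fib (p + 6) + y} := by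
  rw [isAttractor_iff _ (by omega)]
  refine ⟨?_, suff p x y hx hy hxy⟩
  intro k hk
  have g6 : fib (p + 6) = fib (p + 5) + fib (p + 4) := rfl
  have g7 : fib (p + 7) = fib (p + 6) + fib (p + 5) := rfl
  have := Dg_lt _ _ hx
  have := Dg_lt _ _ hy
  simp only [Finset.mem_insert, Finset.mem_singleton] at hk
  rcases hk with rfl | rfl <;> omega

theorem two_le (p : ℕ) (Γ : Finset ℕ) (h : IsAttractor (F (p + 7)) Γ) : 2 ≤ Γ.card := by
  obtain ⟨i, hi, j, hj, h1⟩ := nec1 p Γ ((isAttractor_iff _ (by omega) Γ).1 h).2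
  exact Finset.one_lt_card.2 ⟨i, hi, j, hj, by omega⟩

theorem Att_iff (p : ℕ) (Γ : Finset ℕ) : Γ ∈ Att (F (p + 7)) ↔
    ∃ x y, x ∈ Dg (p + 4) ∧ y ∈ Dg (p + 5) ∧ (y ∈ Dg (p + 3) ∨ x ≤ 1) ∧
      {fib (p + 5) + x, fib (p + 6) + y} = Γ := by
  constructor
  · rintro ⟨h1, h2⟩
    have h3 := h2 _ (attractor_good p 0 0 (zero_mem_Dg _) (zero_mem_Dg _) (Or.inr (by omega)))
    have h4 := h3.trans Finset.card_le_two
    have h5 := ((isAttractor_iff _ (by omega) Γ).1 h1).2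
    obtain ⟨i, hi, j, hj, a1, a2, a3, a4⟩ := nec1 p Γ h5
    have h6 : ({i, j} : Finset ℕ) = Γ := by
      apply Finset.eq_of_subset_of_card_le
      · intro z hz
        simp only [Finset.mem_insert, Finset.mem_singleton] at hz
        rcases hz with rfl | rfl <;> assumption
      · rw [Finset.card_pair (by omega)]; exact h4
    subst h6
    obtain ⟨x, y, hx, hy, hxy, rfl, rfl⟩ := nec2 p i j h5 ⟨a1, a2⟩ ⟨a3, a4⟩
    exact ⟨x, y, hx, hy, hxy, rfl⟩
  · rintro ⟨x, y, hx, hy, hxy, rfl⟩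
    exact ⟨attractor_good p x y hx hy hxy, fun Γ' h' =>
      Finset.card_le_two.trans (two_le p Γ' h')⟩

theorem Dg_small (m : ℕ) : (Dg (m + 1)).filter (· ≤ 1) = if m % 2 = 0 then {0} else {0, 1} := by
  induction m using Nat.strong_induction_on with
  | _ m ih =>
    match m with
    | 0 => decide
    | 1 => decide
    | m + 2 =>
      have h := ih m (by omega)
      rw [show (m + 2) % 2 = m % 2 by omega, ← h]
      ext x
      have q := fib_ge m
      have := mem_Dg (m + 1) x
      simp only [Nat.add_assoc, Nat.reduceAdd] at *
      simp only [Finset.mem_filter, this]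
      constructor
      · rintro ⟨h1 | ⟨y, hy, hy2⟩, h2⟩
        · exact ⟨h1, h2⟩
        · omega
      · rintro ⟨h1, h2⟩
        exact ⟨Or.inl h1, h2⟩

theorem count (p : ℕ) : (Att (F (p + 7))).ncard =
    2 ^ ((p + 4) / 2) * 2 ^ ((p + 3) / 2) +
      (if (p + 3) % 2 = 0 then 1 else 2) * 2 ^ ((p + 3) / 2) := by
  classical
  set P : Finset (ℕ × ℕ) := Dg (p + 4) ×ˢ Dg (p + 3) ∪
    ((Dg (p + 4)).filter (· ≤ 1)) ×ˢ ((Dg (p + 3)).image (· + fib (p + 4))) with hP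
  have g6 : fib (p + 6) = fib (p + 5) + fib (p + 4) := rfl
  have hA : Att (F (p + 7)) =
      ((P.image (fun q => ({fib (p + 5) + q.1, fib (p + 6) + q.2} : Finset ℕ)) :
        Finset (Finset ℕ)) : Set (Finset ℕ)) := by
    ext Γ
    rw [Att_iff]
    simp only [Finset.coe_image, Set.mem_image, Finset.mem_coe, hP, Finset.mem_union,
      Finset.mem_product, Finset.mem_filter, Finset.mem_image, Prod.exists]
    refine exists_congr fun x => exists_congr fun y => ?_
    have := mem_Dg (p + 3) y
    simp only [Nat.add_assoc, Nat.reduceAdd] at this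
    rw [this]
    tauto
  rw [hA, Set.ncard_coe_finset, Finset.card_image_of_injOn, hP, Finset.card_union_of_disjoint,
    Finset.card_product, Finset.card_product, Dg_card, Dg_card,
    Finset.card_image_of_injective _ (add_left_injective _), Dg_card, Dg_small (p + 3)]
  · split_ifs <;> simp
  · rw [Finset.disjoint_left]
    rintro ⟨x, y⟩ h1 h2
    have := Dg_disj (p + 3)
    rw [Finset.disjoint_left] at this
    exact this (Finset.mem_product.1 h1).2 (Finset.mem_product.1 h2).2
  · rintro ⟨x, y⟩ h1 ⟨x', y'⟩ h2 h
    have hx : ∀ x y, (x, y) ∈ P → x < fib (p + 4) := by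
      intro x y h
      simp only [hP, Finset.mem_union, Finset.mem_product, Finset.mem_filter] at h
      exact Dg_lt _ _ (by tauto)
    have b1 := hx x y h1
    have b2 := hx x' y' h2
    simp only at h
    have c1 : fib (p + 5) + x ∈ ({fib (p + 5) + x', fib (p + 6) + y'} : Finset ℕ) := by
      rw [← h]; simp
    have c2 : fib (p + 6) + y ∈ ({fib (p + 5) + x', fib (p + 6) + y'} : Finset ℕ) := by
      rw [← h]; simp
    simp only [Finset.mem_insert, Finset.mem_singleton] at c1 c2
    ext <;> simp only <;> omega

theorem count' (n : ℕ) (hn : 7 ≤ n) :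
    (Att (F n)).ncard = 2 ^ (n - 4) + 2 ^ ((n + 1) / 2 - 2) := by
  obtain ⟨p, rfl⟩ : ∃ p, n = p + 7 := ⟨n - 7, by omega⟩
  rw [count]
  rcases Nat.even_or_odd' p with ⟨q, rfl | rfl⟩
  · rw [if_neg (by omega), show (2 * q + 4) / 2 = q + 2 by omega,
      show (2 * q + 3) / 2 = q + 1 by omega, show 2 * q + 7 - 4 = (q + 2) + (q + 1) by omega,
      show (2 * q + 7 + 1) / 2 - 2 = q + 1 + 1 by omega]
    ring
  · rw [if_pos (by omega), show (2 * q + 1 + 4) / 2 = q + 2 by omega,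
      show (2 * q + 1 + 3) / 2 = q + 2 by omega,
      show 2 * q + 1 + 7 - 4 = (q + 2) + (q + 2) by omega,
      show (2 * q + 1 + 7 + 1) / 2 - 2 = q + 2 by omega, pow_add]
    ring

/-- For every k ≥ 4, F_{2k-1} has (2^{k-3} + 1)·2^{k-2} smallest string
attractors and F_{2k} has (2^{k-2} + 1)·2^{k-2} smallest string attractors; equivalently,
for every n ≥ 7, F_n has 2^{n-4} + 2^{⌈n/2⌉-2} smallest string attractors. -/
theorem fib_att_count :
    (∀ k : ℕ, 4 ≤ k →
      (Att (F (2 * k - 1))).ncard = (2 ^ (k - 3) + 1) * 2 ^ (k - 2) ∧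
      (Att (F (2 * k))).ncard = (2 ^ (k - 2) + 1) * 2 ^ (k - 2)) ∧
    (∀ n : ℕ, 7 ≤ n →
      (Att (F n)).ncard = 2 ^ (n - 4) + 2 ^ ((n + 1) / 2 - 2)) := by
  refine ⟨fun k hk => ⟨?_, ?_⟩, count'⟩
  · obtain ⟨q, rfl⟩ : ∃ q, k = q + 4 := ⟨k - 4, by omega⟩
    rw [count' _ (by omega), show 2 * (q + 4) - 1 - 4 = (q + 1) + (q + 2) by omega,
      show (2 * (q + 4) - 1 + 1) / 2 - 2 = q + 2 by omega, show q + 4 - 3 = q + 1 by omega,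
      show q + 4 - 2 = q + 2 by omega, pow_add]
    ring
  · obtain ⟨q, rfl⟩ : ∃ q, k = q + 4 := ⟨k - 4, by omega⟩
    rw [count' _ (by omega), show 2 * (q + 4) - 4 = (q + 2) + (q + 2) by omega,
      show (2 * (q + 4) + 1) / 2 - 2 = q + 2 by omega,
      show q + 4 - 2 = q + 2 by omega, pow_add]
    ring
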